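/- arXiv:2112.14445 — 9 statements merged into one kernel-verified Lean document; each statement's English description precedes it below -/
import Mathlib

section
/- Let d, k be positive integers, let Δ > 3 and let α be a real number with 0 ≤ α < Δ/2 − 1. Let B_1, …, B_k be a Δ-far family of balls in ℝ^d with centers c_1, …, c_k (pairwise distinct) and radii r_1, …, r_k ≥ 0, and let y_1, …, y_k ∈ ℝ^d be points with ‖y_i − c_i‖ ≤ α·r_i for every i. Then for every index i, every point x ∈ B_i, and every index j ≠ i, it holds that ‖x − y_i‖ < ‖x − y_j‖. (That is, an α-good solution for an instance partitioned by Δ-far balls with α < Δ/2 − 1 clusters the instance correctly.) -/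
/-- An α-good solution for an instance partitioned by Δ-far balls,
with 0 ≤ α < Δ/2 − 1, clusters the instance correctly. -/
theorem good_solution_clusters_correctly
    {d k : ℕ} (hd : 0 < d) (hk : 0 < k) (Δ α : ℝ) (hΔ : 3 < Δ)
    (hα0 : 0 ≤ α) (hα : α < Δ / 2 - 1)
    (c y : Fin k → EuclideanSpace ℝ (Fin d)) (r : Fin k → ℝ)
    (hr : ∀ i, 0 ≤ r i)
    (hc : Function.Injective c)
    (hfar : ∀ i j, i ≠ j → Δ * max (r i) (r j) ≤ dist (c i) (c j))
    (hy : ∀ i, dist (y i) (c i) ≤ α * r i) :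
    ∀ i, ∀ x ∈ Metric.closedBall (c i) (r i), ∀ j, j ≠ i →
      dist x (y i) < dist x (y j) := by
  intro i x hx j hji
  rw [Metric.mem_closedBall] at hx
  have hD : 0 < dist (c i) (c j) := dist_pos.2 fun h => hji (hc h).symm
  have hfar_ij := hfar i j hji.symm
  have hyi := hy i
  have hyj := hy j
  have hri : r i ≤ max (r i) (r j) := le_max_left _ _
  have hrj : r j ≤ max (r i) (r j) := le_max_right _ _
  have hM : 0 ≤ max (r i) (r j) := (hr i).trans hri
  have upper : dist x (y i) ≤ dist x (c i) + dist (y i) (c i) := dist_triangle_right _ _ _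
  have lower : dist (c i) (c j) ≤ dist x (c i) + dist x (y j) + dist (y j) (c j) := by
    simpa only [dist_comm (c i) x] using dist_triangle4 (c i) x (y j) (c j)
  have hαi : α * r i ≤ α * max (r i) (r j) := mul_le_mul_of_nonneg_left hri hα0
  have hαj : α * r j ≤ α * max (r i) (r j) := mul_le_mul_of_nonneg_left hrj hα0
  have gap : (2 + 2 * α) * max (r i) (r j) < dist (c i) (c j) := by
    rcases hM.eq_or_lt with h | h
    · simpa [← h] using hD
    · exact (mul_lt_mul_of_pos_right (by linarith) h).trans_le hfar_ij
  linarith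
end

section
/- Let d, k be positive integers and let Δ > 6. Let B_1, …, B_k with B_i = B(c_i, r_i), and B_1', …, B_k' with B_i' = B(c_i', r_i'), be two Δ-far families of balls in ℝ^d, each family with pairwise distinct centers, such that B_i ∩ B_i' ≠ ∅ for every i. Then for every index i, every point x ∈ B_i ∪ B_i', and every index j ≠ i, it holds that ‖x − c_i‖ < ‖x − c_j‖. -/
/-- If `Δ > 6` and two distinct points are at distance at least `Δ * max a b`, then both
`a` and `b` are less than a sixth of their distance. -/
theorem six_mul_lt_dist_of_far {X : Type*} [MetricSpace X] {Δ a b : ℝ} {p q : X}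
    (hΔ : 6 < Δ) (ha : 0 ≤ a) (hpq : p ≠ q) (hfar : Δ * max a b ≤ dist p q) :
    6 * a < dist p q ∧ 6 * b < dist p q := by
  have hpos : 0 < dist p q := dist_pos.2 hpq
  have hmax : 6 * max a b < dist p q := by
    rcases (ha.trans (le_max_left a b)).eq_or_lt with h | h
    · rw [← h]; linarith
    · exact (mul_lt_mul_of_pos_right hΔ h).trans_le hfar
  exact ⟨by linarith [le_max_left a b], by linarith [le_max_right a b]⟩

/-- Given two Δ-far families of balls (Δ > 6) with `B i ∩ B' i ≠ ∅`
for every `i`, every point of `B i ∪ B' i` is strictly closer to the center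
`c i` than to any other center `c j`. -/
theorem two_far_families_nearest_center
    {d k : ℕ} (hd : 0 < d) (hk : 0 < k) (Δ : ℝ) (hΔ : 6 < Δ)
    (c c' : Fin k → EuclideanSpace ℝ (Fin d)) (r r' : Fin k → ℝ)
    (hr : ∀ i, 0 ≤ r i) (hr' : ∀ i, 0 ≤ r' i)
    (hc : Function.Injective c) (hc' : Function.Injective c')
    (hfar : ∀ i j, i ≠ j → Δ * max (r i) (r j) ≤ dist (c i) (c j))
    (hfar' : ∀ i j, i ≠ j → Δ * max (r' i) (r' j) ≤ dist (c' i) (c' j))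
    (hint : ∀ i, (Metric.closedBall (c i) (r i) ∩
      Metric.closedBall (c' i) (r' i)).Nonempty) :
    ∀ i, ∀ x ∈ Metric.closedBall (c i) (r i) ∪ Metric.closedBall (c' i) (r' i),
      ∀ j, j ≠ i → dist x (c i) < dist x (c j) := by
  intro i x hx j hj
  obtain ⟨hi, hj₁⟩ := six_mul_lt_dist_of_far hΔ (hr i) (hc.ne hj.symm) (hfar i j hj.symm)
  obtain ⟨hi', hj'⟩ := six_mul_lt_dist_of_far hΔ (hr' i) (hc'.ne hj.symm) (hfar' i j hj.symm)
  have htri : dist (c i) (c j) ≤ dist x (c i) + dist x (c j) := dist_triangle_left _ _ _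
  rcases hx with hx | hx
  · rw [Metric.mem_closedBall] at hx
    linarith [hr i]
  · rw [Metric.mem_closedBall] at hx
    obtain ⟨y, hy, hy'⟩ := hint i
    obtain ⟨z, hz, hz'⟩ := hint j
    rw [Metric.mem_closedBall] at hy hy' hz hz'
    have hxi : dist x (c i) ≤ 2 * r' i + r i := by
      linarith [dist_triangle4 x (c' i) y (c i), dist_comm y (c' i)]
    rcases le_total (dist (c i) (c j)) (dist (c' i) (c' j)) with h | h
    · have hxj : dist (c' i) (c' j) ≤ r' i + dist x (c j) + r j + r' j := by
        linarith [dist_triangle4 (c' i) x (c j) (c' j), dist_triangle (c j) z (c' j),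
          dist_comm x (c' i), dist_comm z (c j)]
      linarith
    · linarith
end

section
/- Let d, k be positive integers and let Δ > 6. Let T be a finite multiset of k-tuples of points in ℝ^d that is partitioned by a Δ-far family of balls B_1^*, …, B_k^* with B_i^* = B(c_i^*, r_i^*) and pairwise distinct centers. Let B_1, …, B_k with B_i = B(c_i, r_i) be another Δ-far family of balls with pairwise distinct centers that partitions at least one tuple X = (x_1, …, x_k) of T, with the indexing chosen so that x_i ∈ B_i ∩ B_i^* for every i. Then for every index i and every point p of Points(T): p ∈ B_i^* if and only if for every j ≠ i it holds that ‖p − c_i‖ < ‖p − c_j‖. In particular, assigning each point of Points(T) to its nearest center among c_1, …, c_k recovers exactly the partition {Points(T) ∩ B_1^*, …, Points(T) ∩ B_k^*}. -/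
/-- If two pairs of `Δ`-far balls share the points `x` and `y`, then the points of the first ball of
one pair are strictly closer to the first center of the other pair than to its second center. -/
lemma dist_center_lt_of_far {E : Type*} [PseudoMetricSpace E] {Δ a a' b b' : ℝ} (hΔ : 6 < Δ)
    {u u' v v' x y p : E} (ha : 0 ≤ a) (ha' : 0 ≤ a') (huv : 0 < dist u v)
    (huv' : 0 < dist u' v') (hfar : Δ * max a b ≤ dist u v)
    (hfar' : Δ * max a' b' ≤ dist u' v')
    (hx : dist x u ≤ a) (hx' : dist x u' ≤ a') (hy : dist y v ≤ b) (hy' : dist y v' ≤ b')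
    (hp : dist p u ≤ a) : dist p u' < dist p v' := by
  have hfar_strict : 6 * max a b < dist u v := by
    rcases (ha.trans (le_max_left a b)).eq_or_lt with h | h <;> nlinarith
  have hfar_strict' : 6 * max a' b' < dist u' v' := by
    rcases (ha'.trans (le_max_left a' b')).eq_or_lt with h | h <;> nlinarith
  have hpu' : dist p u' ≤ 2 * a + a' := by
    linarith [dist_triangle4 p u x u', dist_comm x u]
  have huv_le : dist u v ≤ a + dist p v' + b' + b := by
    linarith [dist_triangle4 u p v' v, dist_comm p u, dist_triangle v' y v, dist_comm y v']
  have huv'_le : dist u' v' ≤ dist p u' + dist p v' := dist_triangle_left u' v' p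
  have := le_max_left a b
  have := le_max_right a b
  have := le_max_left a' b'
  have := le_max_right a' b'
  rcases le_total (max a b) (max a' b') with h | h <;> linarith

/-- If every one of `k` pairwise disjoint sets contains exactly one entry of a `k`-tuple, then every
entry lies in one of the sets. -/
lemma exists_mem_of_existsUnique_mem {ι E : Type*} [Finite ι] {B : ι → Set E}
    (hB : Pairwise fun i j => Disjoint (B i) (B j)) {Y : ι → E} (hY : ∀ i, ∃! t, Y t ∈ B i)
    (t : ι) : ∃ i, Y t ∈ B i := by
  choose f hf using fun i => (hY i).exists
  have hinj : Function.Injective f := fun i j hij => by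
    by_contra hne
    exact Set.disjoint_left.mp (hB hne) (hf i) (hij ▸ hf j)
  obtain ⟨i, rfl⟩ := Finite.surjective_of_injective hinj t
  exact ⟨i, hf i⟩

/-- If a multiset `T` of k-tuples is partitioned by a Δ-far family
of balls `B* i = closedBall (cs i) (rs i)` (Δ > 6), and another Δ-far family
`B i = closedBall (c i) (r i)` partitions at least one tuple `X ∈ T`, indexed so
that `X i ∈ B i ∩ B* i` for every `i`, then a point `p` of `Points(T)` lies in
`B* i` iff `c i` is its strictly nearest center among `c 1, …, c k`. -/
theorem nearest_center_recovers_partition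
    {d k : ℕ} (hd : 0 < d) (hk : 0 < k) (Δ : ℝ) (hΔ : 6 < Δ)
    (T : Multiset (Fin k → EuclideanSpace ℝ (Fin d)))
    (cs c : Fin k → EuclideanSpace ℝ (Fin d)) (rs r : Fin k → ℝ)
    (hrs : ∀ i, 0 ≤ rs i) (hr : ∀ i, 0 ≤ r i)
    (hcs : Function.Injective cs) (hc : Function.Injective c)
    (hfars : ∀ i j, i ≠ j → Δ * max (rs i) (rs j) ≤ dist (cs i) (cs j))
    (hfar : ∀ i j, i ≠ j → Δ * max (r i) (r j) ≤ dist (c i) (c j))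
    (hpart : ∀ Y ∈ T, ∀ i, ∃! t : Fin k, Y t ∈ Metric.closedBall (cs i) (rs i))
    (X : Fin k → EuclideanSpace ℝ (Fin d)) (hXT : X ∈ T)
    (hX : ∀ i, X i ∈ Metric.closedBall (c i) (r i) ∩
      Metric.closedBall (cs i) (rs i)) :
    ∀ i, ∀ p : EuclideanSpace ℝ (Fin d), (∃ Y ∈ T, ∃ t : Fin k, Y t = p) →
      (p ∈ Metric.closedBall (cs i) (rs i) ↔
        ∀ j, j ≠ i → dist p (c i) < dist p (c j)) := by
  have hforward : ∀ i j, j ≠ i → ∀ p, p ∈ Metric.closedBall (cs i) (rs i) →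
      dist p (c i) < dist p (c j) := fun i j hji p hp =>
    dist_center_lt_of_far hΔ (hrs i) (hr i) (dist_pos.mpr (hcs.ne hji.symm))
      (dist_pos.mpr (hc.ne hji.symm)) (hfars i j hji.symm) (hfar i j hji.symm)
      (hX i).2 (hX i).1 (hX j).2 (hX j).1 hp
  have hdisj : Pairwise fun i j =>
      Disjoint (Metric.closedBall (cs i) (rs i)) (Metric.closedBall (cs j) (rs j)) :=
    fun i j hij => Set.disjoint_left.mpr fun p hpi hpj =>
      lt_asymm (hforward i j hij.symm p hpi) (hforward j i hij p hpj)
  rintro i p ⟨Y, hYT, t, rfl⟩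
  refine ⟨fun hp j hji => hforward i j hji _ hp, fun hnear => ?_⟩
  obtain ⟨j, hj⟩ := exists_mem_of_existsUnique_mem hdisj (hpart Y hYT) t
  rcases eq_or_ne j i with rfl | hji
  · exact hj
  · exact absurd (hnear j hji) (hforward j i hji.symm _ hj).not_gt
end

section
/- Let d be a positive integer, k ≥ 2 an integer, and Δ > 6. Let B_1, …, B_k with B_i = B(c_i, r_i), and B_1', …, B_k' with B_i' = B(c_i', r_i'), be two Δ-far families of balls in ℝ^d, and suppose there exist points x_1, …, x_k with x_i ∈ B_i ∩ B_i' for every i. Then for every index i: (a) ‖c_i − c_i'‖ ≤ r_i + r_i' ≤ (1/Δ)·( min_{j ≠ i} ‖c_i − c_j‖ + min_{j ≠ i} ‖c_i' − c_j'‖ ); and (b) min_{j ≠ i} ‖c_i − c_j‖ ≤ (1 + 4/(Δ−2))·min_{j ≠ i} ‖c_i' − c_j'‖. -/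
/-- The centers of two closed balls with a common point are at most the sum of the radii apart. -/
theorem dist_centers_le_of_mem_closedBall_inter {E : Type*} [PseudoMetricSpace E]
    {c c' x : E} {r r' : ℝ} (hx : x ∈ Metric.closedBall c r ∩ Metric.closedBall c' r') :
    dist c c' ≤ r + r' :=
  (dist_triangle_left c c' x).trans
    (add_le_add (Metric.mem_closedBall.1 hx.1) (Metric.mem_closedBall.1 hx.2))

/-- Two pairs of far balls with corresponding balls meeting have comparable center distances. -/
theorem dist_le_mul_dist_of_far_of_close {E : Type*} [PseudoMetricSpace E]
    {Δ : ℝ} (hΔ : 2 < Δ) {p q p' q' : E} {r s r' s' : ℝ}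
    (hfar : Δ * max r s ≤ dist p q) (hfar' : Δ * max r' s' ≤ dist p' q')
    (hp : dist p p' ≤ r + r') (hq : dist q q' ≤ s + s') :
    dist p q ≤ (1 + 4 / (Δ - 2)) * dist p' q' := by
  have hpos : 0 < Δ - 2 := by linarith
  have hΔ0 : 0 ≤ Δ := by linarith
  have htri : dist p q ≤ dist p p' + dist p' q' + dist q q' := by
    simpa [dist_comm] using dist_triangle4 p p' q' q
  have hr := (mul_le_mul_of_nonneg_left (le_max_left r s) hΔ0).trans hfar
  have hs := (mul_le_mul_of_nonneg_left (le_max_right r s) hΔ0).trans hfar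
  have hr' := (mul_le_mul_of_nonneg_left (le_max_left r' s') hΔ0).trans hfar'
  have hs' := (mul_le_mul_of_nonneg_left (le_max_right r' s') hΔ0).trans hfar'
  have hmul : Δ * dist p q ≤ Δ * (dist p' q' + (r + r') + (s + s')) :=
    mul_le_mul_of_nonneg_left (by linarith) hΔ0
  have hcoef : 1 + 4 / (Δ - 2) = (Δ + 2) / (Δ - 2) := by
    field_simp
    ring
  rw [hcoef, div_mul_eq_mul_div, le_div_iff₀ hpos]
  linarith

/-- For two Δ-far families of balls (Δ > 6) whose corresponding
balls share a common point `x i ∈ B i ∩ B' i`: (a) the corresponding centers are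
within `r i + r' i`, which is at most (1/Δ) times the sum of the two minimal
center gaps; (b) the minimal center gap of the first family is at most
`(1 + 4/(Δ−2))` times that of the second. -/
theorem close_far_families_min_gaps
    {d k : ℕ} (hd : 0 < d) (hk : 2 ≤ k) (Δ : ℝ) (hΔ : 6 < Δ)
    (c c' x : Fin k → EuclideanSpace ℝ (Fin d)) (r r' : Fin k → ℝ)
    (hr : ∀ i, 0 ≤ r i) (hr' : ∀ i, 0 ≤ r' i)
    (hfar : ∀ i j, i ≠ j → Δ * max (r i) (r j) ≤ dist (c i) (c j))
    (hfar' : ∀ i j, i ≠ j → Δ * max (r' i) (r' j) ≤ dist (c' i) (c' j))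
    (hx : ∀ i, x i ∈ Metric.closedBall (c i) (r i) ∩
      Metric.closedBall (c' i) (r' i)) :
    ∀ i,
      (dist (c i) (c' i) ≤ r i + r' i ∧
        r i + r' i ≤ (1 / Δ) *
          ((⨅ j : {j : Fin k // j ≠ i}, dist (c i) (c j.1)) +
            (⨅ j : {j : Fin k // j ≠ i}, dist (c' i) (c' j.1)))) ∧
      (⨅ j : {j : Fin k // j ≠ i}, dist (c i) (c j.1)) ≤
        (1 + 4 / (Δ - 2)) * ⨅ j : {j : Fin k // j ≠ i}, dist (c' i) (c' j.1) := by
  intro i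
  have hclose j := dist_centers_le_of_mem_closedBall_inter (hx j)
  have hΔ0 : 0 < Δ := by linarith
  have : Nontrivial (Fin k) := Fin.nontrivial_iff_two_le.2 hk
  have : Nonempty {j : Fin k // j ≠ i} := nonempty_subtype.2 (exists_ne i)
  have hgap : Δ * r i ≤ ⨅ j : {j : Fin k // j ≠ i}, dist (c i) (c j.1) :=
    le_ciInf fun j => (mul_le_mul_of_nonneg_left (le_max_left _ _) hΔ0.le).trans
      (hfar i j.1 j.2.symm)
  have hgap' : Δ * r' i ≤ ⨅ j : {j : Fin k // j ≠ i}, dist (c' i) (c' j.1) :=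
    le_ciInf fun j => (mul_le_mul_of_nonneg_left (le_max_left _ _) hΔ0.le).trans
      (hfar' i j.1 j.2.symm)
  refine ⟨⟨hclose i, ?_⟩, ?_⟩
  · rw [one_div_mul_eq_div, le_div_iff₀ hΔ0]
    linarith
  · have hcoef : 0 ≤ 1 + 4 / (Δ - 2) := by
      have : 0 < Δ - 2 := by linarith
      positivity
    rw [Real.mul_iInf_of_nonneg hcoef]
    refine ciInf_mono (Set.finite_range _).bddBelow fun j => ?_
    exact dist_le_mul_dist_of_far_of_close (by linarith) (hfar i j.1 j.2.symm)
      (hfar' i j.1 j.2.symm) (hclose i) (hclose j.1)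
end

section
/- Let d be a positive integer, k ≥ 2 an integer, and γ a real number with 0 ≤ γ ≤ 1/8. Let P be a finite multiset of points in ℝ^d, let C = (c_1, …, c_k) and C' = (c_1', …, c_k') be k-tuples of points in ℝ^d such that ‖c_i' − c_i‖ ≤ γ·D_i for every i, where D_i = min_{j ≠ i} ‖c_i − c_j‖. Let a assign to each point x of P an index a(x) ∈ {1, …, k} such that ‖x − c'_{a(x)}‖ ≤ ‖x − c'_j‖ for every j (i.e., each point is assigned to a nearest center of C'), and let P_i be the sub-multiset of points assigned to index i. Then Σ_{i=1}^k inf_{b ∈ ℝ^d} Σ_{x ∈ P_i} ‖x − b‖² ≤ (1 + 32γ)·COST_P(C). -/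
/-- A sum over a multiset splits along the fibres of a map to a finite type. -/
theorem Multiset.sum_sum_map_filter_eq {α ι M : Type*} [Fintype ι] [DecidableEq ι]
    [AddCommMonoid M] (P : Multiset α) (a : α → ι) (f : ι → α → M) :
    ∑ i, ((P.filter fun x => a x = i).map (f i)).sum = (P.map fun x => f (a x) x).sum := by
  induction P using Multiset.induction_on with
  | empty => simp
  | cons x P ih =>
    have h : ∀ i, (((x ::ₘ P).filter fun y => a y = i).map (f i)).sum =
        (if a x = i then f i x else 0) + ((P.filter fun y => a y = i).map (f i)).sum := by
      intro i
      by_cases hi : a x = i <;> simp [hi]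
    simp [h, Finset.sum_add_distrib, ih]

/-- If `y` is within `γ * dist p q` of `p`, `z` is within `γ * dist p q` of `q`, and `x` is at
least as close to `y` as to `z`, then `x` is almost as close to `p` as to `q`. -/
theorem sq_dist_le_of_perturbed_nearest {X : Type*} [PseudoMetricSpace X] {γ : ℝ}
    (hγ0 : 0 ≤ γ) (hγ : γ ≤ 1 / 8) {x p q y z : X}
    (hy : dist y p ≤ γ * dist p q) (hz : dist z q ≤ γ * dist p q)
    (hx : dist x y ≤ dist x z) :
    dist x p ^ 2 ≤ (1 + 32 * γ) * dist x q ^ 2 := by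
  have hp := dist_triangle x y p
  have hq := dist_triangle_right x z q
  have hpq : γ * dist p q ≤ γ * (dist x p + dist x q) :=
    mul_le_mul_of_nonneg_left (dist_triangle_left p q x) hγ0
  have hlin : (1 - 2 * γ) * dist x p ≤ (1 + 2 * γ) * dist x q := by linarith
  have hsq : ((1 - 2 * γ) * dist x p) ^ 2 ≤ ((1 + 2 * γ) * dist x q) ^ 2 :=
    pow_le_pow_left₀ (mul_nonneg (by linarith) dist_nonneg) hlin 2
  have hcoef : (1 + 2 * γ) ^ 2 ≤ (1 + 32 * γ) * (1 - 2 * γ) ^ 2 := by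
    nlinarith [mul_nonneg hγ0 (sub_nonneg.2 hγ), pow_nonneg hγ0 3]
  have hpos : 0 < (1 - 2 * γ) ^ 2 := pow_pos (by linarith) 2
  refine le_of_mul_le_mul_left ?_ hpos
  calc (1 - 2 * γ) ^ 2 * dist x p ^ 2 ≤ (1 + 2 * γ) ^ 2 * dist x q ^ 2 := by
        simpa only [mul_pow] using hsq
    _ ≤ (1 + 32 * γ) * (1 - 2 * γ) ^ 2 * dist x q ^ 2 := by gcongr
    _ = (1 - 2 * γ) ^ 2 * ((1 + 32 * γ) * dist x q ^ 2) := by ring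

/-- If each perturbed center `c' i` is within `γ·D i` of `c i`
(where `D i` is the minimal distance from `c i` to the other centers) and each
point of `P` is assigned to a nearest perturbed center, then the sum over the
clusters of the optimal 1-means costs is at most `(1 + 32γ)·COST_P(C)`. -/
theorem close_centers_have_similar_cost
    {d k : ℕ} (hd : 0 < d) (hk : 2 ≤ k) (γ : ℝ) (hγ0 : 0 ≤ γ) (hγ : γ ≤ 1 / 8)
    (P : Multiset (EuclideanSpace ℝ (Fin d)))
    (c c' : Fin k → EuclideanSpace ℝ (Fin d))
    (hcc : ∀ i, dist (c' i) (c i) ≤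
      γ * ⨅ j : {j : Fin k // j ≠ i}, dist (c i) (c j.1))
    (a : EuclideanSpace ℝ (Fin d) → Fin k)
    (ha : ∀ x ∈ P, ∀ j, dist x (c' (a x)) ≤ dist x (c' j)) :
    ∑ i : Fin k,
        ⨅ b : EuclideanSpace ℝ (Fin d),
          ((P.filter fun x => a x = i).map fun x => dist x b ^ 2).sum
      ≤ (1 + 32 * γ) * (P.map fun x => ⨅ i : Fin k, dist x (c i) ^ 2).sum := by
  have : NeZero k := ⟨by omega⟩
  have hsep : ∀ i j, j ≠ i → dist (c' i) (c i) ≤ γ * dist (c i) (c j) := fun i j hij =>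
    (hcc i).trans (mul_le_mul_of_nonneg_left
      (ciInf_le (Set.finite_range fun j : {j : Fin k // j ≠ i} => dist (c i) (c j.1)).bddBelow
        ⟨j, hij⟩) hγ0)
  have hpoint : ∀ x ∈ P,
      dist x (c (a x)) ^ 2 ≤ (1 + 32 * γ) * ⨅ i : Fin k, dist x (c i) ^ 2 := by
    intro x hx
    obtain ⟨j, hj⟩ := exists_eq_ciInf_of_finite (f := fun i : Fin k => dist x (c i) ^ 2)
    rw [← hj]
    rcases eq_or_ne j (a x) with h | h
    · rw [h]
      exact le_mul_of_one_le_left (sq_nonneg _) (by linarith)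
    · exact sq_dist_le_of_perturbed_nearest hγ0 hγ (hsep _ _ h)
        (dist_comm (c j) (c (a x)) ▸ hsep _ _ h.symm) (ha x hx j)
  calc _ ≤ ∑ i : Fin k, ((P.filter fun x => a x = i).map fun x => dist x (c i) ^ 2).sum := by
        refine Finset.sum_le_sum fun i _ => ciInf_le ⟨0, ?_⟩ (c i)
        rintro _ ⟨b, rfl⟩
        refine Multiset.sum_nonneg fun y hy => ?_
        obtain ⟨x, -, rfl⟩ := Multiset.mem_map.1 hy
        exact sq_nonneg _
    _ = (P.map fun x => dist x (c (a x)) ^ 2).sum :=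
        P.sum_sum_map_filter_eq a fun i x => dist x (c i) ^ 2
    _ ≤ (P.map fun x => (1 + 32 * γ) * ⨅ i : Fin k, dist x (c i) ^ 2).sum :=
        Multiset.sum_map_le_sum_map _ _ hpoint
    _ = _ := Multiset.sum_map_mul_left
end

section
/- Let d be a positive integer and γ a real number with 0 ≤ γ ≤ 1/8. Let c, e, p, q, x ∈ ℝ^d satisfy ‖p − c‖ ≤ γ·‖c − e‖, ‖q − e‖ ≤ γ·‖c − e‖, ‖x − q‖ ≤ ‖x − p‖, and ‖x − c‖ ≤ ‖x − e‖. Then ‖x − e‖² ≤ (1 + 32γ)·‖x − c‖². -/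
/-- Pointwise estimate for k-means cost comparison under
perturbation of centers: if `p` is a γ-perturbation of `c`, `q` is a
γ-perturbation of `e` (relative to `‖c − e‖`), `x` is at least as close to `q`
as to `p`, and at least as close to `c` as to `e`, then
`‖x − e‖² ≤ (1 + 32γ)·‖x − c‖²`. -/
theorem pointwise_perturbed_center_estimate
    {d : ℕ} (hd : 0 < d) (γ : ℝ) (hγ0 : 0 ≤ γ) (hγ : γ ≤ 1 / 8)
    (c e p q x : EuclideanSpace ℝ (Fin d))
    (hp : ‖p - c‖ ≤ γ * ‖c - e‖)
    (hq : ‖q - e‖ ≤ γ * ‖c - e‖)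
    (hxq : ‖x - q‖ ≤ ‖x - p‖)
    (hxc : ‖x - c‖ ≤ ‖x - e‖) :
    ‖x - e‖ ^ 2 ≤ (1 + 32 * γ) * ‖x - c‖ ^ 2 := by
  have hxe : ‖x - e‖ ≤ ‖x - q‖ + ‖q - e‖ := norm_sub_le_norm_sub_add_norm_sub x q e
  have hxp : ‖x - p‖ ≤ ‖x - c‖ + ‖p - c‖ := by
    simpa only [norm_sub_rev c p] using norm_sub_le_norm_sub_add_norm_sub x c p
  have hce : ‖c - e‖ ≤ ‖x - c‖ + ‖x - e‖ := by
    simpa only [norm_sub_rev c x] using norm_sub_le_norm_sub_add_norm_sub c x e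
  have ha : 0 ≤ ‖x - c‖ := norm_nonneg _
  have hshift : γ * ‖c - e‖ ≤ γ * (‖x - c‖ + ‖x - e‖) := by gcongr
  have hratio : (1 - 2 * γ) * ‖x - e‖ ≤ (1 - 2 * γ) * ((1 + 6 * γ) * ‖x - c‖) := by
    have hslack : 0 ≤ γ * (2 - 12 * γ) * ‖x - c‖ :=
      mul_nonneg (mul_nonneg hγ0 (by linarith)) ha
    linarith
  have hlinear : ‖x - e‖ ≤ (1 + 6 * γ) * ‖x - c‖ :=
    le_of_mul_le_mul_left hratio (by linarith)
  calc
    ‖x - e‖ ^ 2 ≤ ((1 + 6 * γ) * ‖x - c‖) ^ 2 := by gcongr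
    _ = (1 + 6 * γ) ^ 2 * ‖x - c‖ ^ 2 := mul_pow _ _ _
    _ ≤ (1 + 32 * γ) * ‖x - c‖ ^ 2 := by
      gcongr
      nlinarith
end

section
/- Let d, k be positive integers, Λ > 0, M ≥ 0, and ω ≥ 1. Let P and S be nonempty finite multisets of points in the closed ball B(0, Λ) ⊆ ℝ^d with |P| = n and |S| = s. Suppose that: (i) for every k-tuple C of centers in B(0, Λ), |(n/s)·COST_S(C) − COST_P(C)| ≤ √(M·COST_P(C)); (ii) C*_P and C*_S are k-tuples of centers in B(0, Λ) minimizing COST_P and COST_S, respectively, over all k-tuples of centers in B(0, Λ); and (iii) C̃ is a k-tuple of centers in B(0, Λ) with COST_S(C̃) ≤ ω·COST_S(C*_S). Then COST_P(C̃) ≤ ω·( COST_P(C*_P) + √(M·COST_P(C*_P)) ) + √(M·COST_P(C̃)). -/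
/-- The k-means cost of a multiset of points w.r.t. a k-tuple of centers. -/
noncomputable def kMeansCost {d k : ℕ} (Q : Multiset (EuclideanSpace ℝ (Fin d)))
    (C : Fin k → EuclideanSpace ℝ (Fin d)) : ℝ :=
  (Q.map fun x => ⨅ i : Fin k, dist x (C i) ^ 2).sum

/-- If the cost of every k-tuple of centers on the sample `S`
(rescaled) approximates its cost on `P` up to `√(M·COST_P(C))`, then an
ω-approximate solution for `S` is almost ω-approximate for `P`. -/
theorem cost_of_sample_is_good
    {d k : ℕ} (hd : 0 < d) (hk : 0 < k) (Λ M ω : ℝ)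
    (hΛ : 0 < Λ) (hM : 0 ≤ M) (hω : 1 ≤ ω)
    (P S : Multiset (EuclideanSpace ℝ (Fin d))) (hP : P ≠ 0) (hS : S ≠ 0)
    (hPmem : ∀ x ∈ P, x ∈ Metric.closedBall (0 : EuclideanSpace ℝ (Fin d)) Λ)
    (hSmem : ∀ x ∈ S, x ∈ Metric.closedBall (0 : EuclideanSpace ℝ (Fin d)) Λ)
    (happrox : ∀ C : Fin k → EuclideanSpace ℝ (Fin d),
      (∀ i, C i ∈ Metric.closedBall (0 : EuclideanSpace ℝ (Fin d)) Λ) →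
      |(P.card : ℝ) / (S.card : ℝ) * kMeansCost S C - kMeansCost P C| ≤
        Real.sqrt (M * kMeansCost P C))
    (Cp Cs Ct : Fin k → EuclideanSpace ℝ (Fin d))
    (hCp : ∀ i, Cp i ∈ Metric.closedBall (0 : EuclideanSpace ℝ (Fin d)) Λ)
    (hCs : ∀ i, Cs i ∈ Metric.closedBall (0 : EuclideanSpace ℝ (Fin d)) Λ)
    (hCt : ∀ i, Ct i ∈ Metric.closedBall (0 : EuclideanSpace ℝ (Fin d)) Λ)
    (hCpmin : ∀ C : Fin k → EuclideanSpace ℝ (Fin d),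
      (∀ i, C i ∈ Metric.closedBall (0 : EuclideanSpace ℝ (Fin d)) Λ) →
      kMeansCost P Cp ≤ kMeansCost P C)
    (hCsmin : ∀ C : Fin k → EuclideanSpace ℝ (Fin d),
      (∀ i, C i ∈ Metric.closedBall (0 : EuclideanSpace ℝ (Fin d)) Λ) →
      kMeansCost S Cs ≤ kMeansCost S C)
    (hCtapprox : kMeansCost S Ct ≤ ω * kMeansCost S Cs) :
    kMeansCost P Ct ≤
      ω * (kMeansCost P Cp + Real.sqrt (M * kMeansCost P Cp)) +
        Real.sqrt (M * kMeansCost P Ct) := by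
  have hratio : (0 : ℝ) ≤ (P.card : ℝ) / (S.card : ℝ) := by positivity
  have hsample : kMeansCost S Ct ≤ ω * kMeansCost S Cp :=
    hCtapprox.trans (mul_le_mul_of_nonneg_left (hCsmin Cp hCp) (by linarith))
  have hCt_lower := (abs_le.mp (happrox Ct hCt)).1
  have hCp_upper := (abs_le.mp (happrox Cp hCp)).2
  calc kMeansCost P Ct
      ≤ (P.card : ℝ) / (S.card : ℝ) * kMeansCost S Ct + Real.sqrt (M * kMeansCost P Ct) := by
        linarith
    _ ≤ (P.card : ℝ) / (S.card : ℝ) * (ω * kMeansCost S Cp) +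
          Real.sqrt (M * kMeansCost P Ct) := by
        gcongr
    _ = ω * ((P.card : ℝ) / (S.card : ℝ) * kMeansCost S Cp) +
          Real.sqrt (M * kMeansCost P Ct) := by
        ring
    _ ≤ ω * (kMeansCost P Cp + Real.sqrt (M * kMeansCost P Cp)) +
          Real.sqrt (M * kMeansCost P Ct) := by
        gcongr
        linarith
end

section
/- Let k be a positive integer and let n, n_1, …, n_k, B, L_1, …, L_k be real numbers such that n_i ≥ 0 for all i, Σ_{i=1}^k n_i = n, B ≥ 0, k·B < n, and |L_i| ≤ B for every i. Then for every index i, | (n_i + L_i)/(n + Σ_{j=1}^k L_j) − n_i/n | ≤ k·B/(n − k·B). -/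
/-- Mixing weights computed from noisy cluster sizes (each size
perturbed by at most `B`) deviate from the true weights by at most
`k·B/(n − k·B)`. -/
theorem noisy_weights_estimate
    {k : ℕ} (hk : 0 < k) (n : ℝ) (ni L : Fin k → ℝ) (B : ℝ)
    (hni : ∀ i, 0 ≤ ni i) (hsum : ∑ i, ni i = n)
    (hB : 0 ≤ B) (hkB : (k : ℝ) * B < n)
    (hL : ∀ i, |L i| ≤ B) :
    ∀ i, |(ni i + L i) / (n + ∑ j, L j) - ni i / n| ≤
      (k : ℝ) * B / (n - (k : ℝ) * B) := by
  intro i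
  have hn : 0 < n := (mul_nonneg k.cast_nonneg hB).trans_lt hkB
  have hk1 : (1 : ℝ) ≤ k := by exact_mod_cast hk
  -- Split the total noise into the noise of cluster `i` and the rest `R`.
  obtain ⟨R, hS, hR⟩ : ∃ R, ∑ j, L j = L i + R ∧ |R| ≤ (k - 1) * B := by
    refine ⟨∑ j ∈ Finset.univ.erase i, L j,
      (Finset.add_sum_erase _ _ (Finset.mem_univ i)).symm, ?_⟩
    calc |∑ j ∈ Finset.univ.erase i, L j|
        ≤ ∑ j ∈ Finset.univ.erase i, |L j| := Finset.abs_sum_le_sum_abs _ _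
      _ ≤ ∑ _j ∈ Finset.univ.erase i, B := Finset.sum_le_sum fun j _ => hL j
      _ = (k - 1) * B := by
        simp [Finset.card_erase_of_mem, Nat.cast_sub (Nat.succ_le_of_lt hk)]
  have hi : ni i ≤ n :=
    hsum ▸ Finset.single_le_sum (fun j _ => hni j) (Finset.mem_univ i)
  have hp0 : 0 ≤ ni i / n := div_nonneg (hni i) hn.le
  have hp1 : ni i / n ≤ 1 := (div_le_one hn).2 hi
  have hLi := abs_le.1 (hL i)
  have hR' := abs_le.1 hR
  have hden : n - k * B ≤ n + ∑ j, L j := by rw [hS]; linarith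
  have hpos : 0 < n + ∑ j, L j := (sub_pos.2 hkB).trans_le hden
  have hdiff : (ni i + L i) / (n + ∑ j, L j) - ni i / n =
      ((1 - ni i / n) * L i - ni i / n * R) / (n + ∑ j, L j) := by
    rw [hS] at hpos ⊢
    field_simp
    ring
  have hnum : |(1 - ni i / n) * L i - ni i / n * R| ≤ k * B := by
    calc |(1 - ni i / n) * L i - ni i / n * R|
        ≤ |(1 - ni i / n) * L i| + |ni i / n * R| := abs_sub _ _
      _ = (1 - ni i / n) * |L i| + ni i / n * |R| := by
        rw [abs_mul, abs_mul, abs_of_nonneg hp0, abs_of_nonneg (sub_nonneg.2 hp1)]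
      _ ≤ 1 * B + 1 * ((k - 1) * B) := by
        gcongr
        · linarith
        · exact hL i
      _ = k * B := by ring
  rw [hdiff, abs_div, abs_of_pos hpos]
  exact div_le_div₀ (mul_nonneg k.cast_nonneg hB) hnum (sub_pos.2 hkB) hden
end

section
/- Let d be a positive integer, k ≥ 2 an integer, γ > 0, h ≥ 0, and set Δ = 8 + 12/γ. Let μ_1, …, μ_k ∈ ℝ^d, let σ_1, …, σ_k ≥ 0 be real numbers, and let a_1, …, a_k ∈ ℝ^d. Suppose that for all i ≠ j, ‖μ_i − μ_j‖ ≥ (1+γ)·h·max{σ_i, σ_j}, and that for every i, ‖a_i − μ_i‖ ≤ (2(1+γ)·h/Δ)·σ_i. Then for all i ≠ j: (a) ‖a_j − μ_i‖ ≥ (1 + γ/2)·h·max{σ_i, σ_j}; and (b) ‖a_i − μ_i‖ ≤ ( (γ/2)/(3·(1 + γ/2)) )·‖a_j − μ_i‖. -/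
/-- For (1+γ)h-separated means with directional standard
deviations σ_i, any estimates a_i of the means with error at most
(2(1+γ)h/Δ)·σ_i (where Δ = 8 + 12/γ) satisfy: (a) a_j is far from μ_i for
j ≠ i; (b) a_i is much closer to μ_i than a_j is. -/
theorem separated_means_estimates
    {d k : ℕ} (hd : 0 < d) (hk : 2 ≤ k) (γ h Δ : ℝ)
    (hγ : 0 < γ) (hh : 0 ≤ h) (hΔ : Δ = 8 + 12 / γ)
    (μ a : Fin k → EuclideanSpace ℝ (Fin d)) (σ : Fin k → ℝ)
    (hσ : ∀ i, 0 ≤ σ i)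
    (hsep : ∀ i j, i ≠ j → (1 + γ) * h * max (σ i) (σ j) ≤ ‖μ i - μ j‖)
    (hest : ∀ i, ‖a i - μ i‖ ≤ 2 * (1 + γ) * h / Δ * σ i) :
    ∀ i j, i ≠ j →
      ((1 + γ / 2) * h * max (σ i) (σ j) ≤ ‖a j - μ i‖) ∧
      (‖a i - μ i‖ ≤ (γ / 2) / (3 * (1 + γ / 2)) * ‖a j - μ i‖) := by
  intro i j hij
  set M := max (σ i) (σ j)
  have hM : 0 ≤ M := (hσ i).trans (le_max_left _ _)
  set t := (1 + γ) * h * M with ht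
  have err : ∀ l, σ l ≤ M → ‖a l - μ l‖ ≤ γ / (4 * γ + 6) * t := fun l hl =>
    calc ‖a l - μ l‖ ≤ 2 * (1 + γ) * h / Δ * σ l := hest l
      _ ≤ 2 * (1 + γ) * h / Δ * M := by
        have : 0 < Δ := by rw [hΔ]; positivity
        gcongr
      _ = γ / (4 * γ + 6) * t := by
        rw [hΔ, ht]
        field_simp
        ring
  have far : (3 * γ + 6) / (4 * γ + 6) * t ≤ ‖a j - μ i‖ := by
    have tri := norm_sub_le_norm_sub_add_norm_sub (μ i) (a j) (μ j)
    rw [norm_sub_rev (μ i) (a j)] at tri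
    have split : (3 * γ + 6) / (4 * γ + 6) * t = t - γ / (4 * γ + 6) * t := by
      field_simp
      ring
    linarith [hsep i j hij, err j (le_max_right _ _)]
  constructor
  · refine le_trans ?_ far
    have coeff : 1 + γ / 2 ≤ (3 * γ + 6) / (4 * γ + 6) * (1 + γ) := by
      rw [div_mul_eq_mul_div, le_div_iff₀ (by positivity)]
      nlinarith [sq_nonneg γ]
    calc (1 + γ / 2) * h * M = (1 + γ / 2) * (h * M) := by ring
      _ ≤ (3 * γ + 6) / (4 * γ + 6) * (1 + γ) * (h * M) := by gcongr
      _ = (3 * γ + 6) / (4 * γ + 6) * t := by rw [ht]; ring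
  · calc ‖a i - μ i‖ ≤ γ / (4 * γ + 6) * t := err i (le_max_left _ _)
      _ = (γ / 2) / (3 * (1 + γ / 2)) * ((3 * γ + 6) / (4 * γ + 6) * t) := by
        field_simp
        ring
      _ ≤ (γ / 2) / (3 * (1 + γ / 2)) * ‖a j - μ i‖ := by gcongr
end
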